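/- Suppose X and Y are metric spaces and the domain D of c is open in X × Y. If G is a nonempty subset of D that is topologically connected (in the subspace topology of X × Y), then G is ball chain connected. -/

import Mathlib

open scoped BigOperators

namespace Paper

variable {X Y : Type*}

/-- The domain of the cost `c`, i.e. the set where `c` is finite. -/
def Dom (c : X × Y → EReal) : Set (X × Y) := {p | c p < ⊤}

/-- `z` is a path in `G` from `p` to `q` (with `N` steps). -/
def IsPath (c : X × Y → EReal) (G : Set (X × Y)) (p q : X × Y)
    (N : ℕ) (z : Fin (N + 1) → X × Y) : Prop :=
  (∀ k, z k ∈ G) ∧ z 0 = p ∧ z (Fin.last N) = q ∧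
    ∀ k : Fin N, c ((z k.succ).1, (z k.castSucc).2) < ⊤

/-- The inner variation `∑_{k=1}^N (c(x_k,y_k) − c(x_{k+1},y_k))` along a path; all the
terms involved are finite for a path in `G ⊆ Dom c`, so the real-valued sum is faithful. -/
noncomputable def pathSum (c : X × Y → EReal) {N : ℕ} (z : Fin (N + 1) → X × Y) : ℝ :=
  ∑ k : Fin N, ((c (z k.castSucc)).toReal - (c ((z k.succ).1, (z k.castSucc).2)).toReal)

/-- The maximal inner variation `F_G(p,q)`, with the convention `sSup ∅ = ⊥ = −∞`. -/
noncomputable def innerVar (c : X × Y → EReal) (G : Set (X × Y)) (p q : X × Y) : EReal :=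
  sSup {s : EReal | ∃ (N : ℕ) (z : Fin (N + 1) → X × Y),
    IsPath c G p q N z ∧ s = ((pathSum c z : ℝ) : EReal)}

/-- `G` is `c`-path bounded. -/
def PathBounded (c : X × Y → EReal) (G : Set (X × Y)) : Prop :=
  ∀ p ∈ G, ∀ q ∈ G, innerVar c G p q < ⊤

/-- `G` is `c`-cyclically monotone. -/
def CyclicallyMonotone (c : X × Y → EReal) (G : Set (X × Y)) : Prop :=
  ∀ p ∈ G, innerVar c G p p ≤ 0

/-- `f` is a `c`-antiderivative of `G`:
`c(x,y) − c(u,y) ≤ f(x,y) − f(u,v)` in `[−∞,+∞]` for all `(x,y),(u,v) ∈ G`. -/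
def IsAntideriv (c : X × Y → EReal) (G : Set (X × Y)) (f : X × Y → ℝ) : Prop :=
  ∀ p ∈ G, ∀ q ∈ G, c p - c (q.1, p.2) ≤ (f p : EReal) - (f q : EReal)

/-- `p` and `q` are strongly connected (mutually reachable by paths) in `G`. -/
def StronglyConn (c : X × Y → EReal) (G : Set (X × Y)) (p q : X × Y) : Prop :=
  (∃ N z, IsPath c G p q N z) ∧ (∃ N z, IsPath c G q p N z)

/-- The ℓ²-product distance `√(d_X(x,u)² + d_Y(y,v)²)` on `X × Y`. -/
noncomputable def dist2 [PseudoMetricSpace X] [PseudoMetricSpace Y] (p q : X × Y) : ℝ :=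
  Real.sqrt (dist p.1 q.1 ^ 2 + dist p.2 q.2 ^ 2)

/-- The open ball for the ℓ²-product distance. -/
def ball2 [PseudoMetricSpace X] [PseudoMetricSpace Y] (p : X × Y) (r : ℝ) : Set (X × Y) :=
  {q | dist2 p q < r}

/-- The maximal open ball centered at `p` contained in `Dom c`, i.e. `B_{ρ(p)}(p)` where
`ρ(p) = sup {r > 0 | B_r(p) ⊆ Dom c}`; note `dist2 p q < ρ(p)` iff there exists `r > 0`
with `B_r(p) ⊆ Dom c` and `dist2 p q < r`. -/
def MaxBall [PseudoMetricSpace X] [PseudoMetricSpace Y]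
    (c : X × Y → EReal) (p : X × Y) : Set (X × Y) :=
  {q | ∃ r : ℝ, 0 < r ∧ ball2 p r ⊆ Dom c ∧ dist2 p q < r}

/-- `z` is a ball chain in `G` from `p` to `q`. -/
def IsBallChain [PseudoMetricSpace X] [PseudoMetricSpace Y]
    (c : X × Y → EReal) (G : Set (X × Y)) (p q : X × Y)
    (N : ℕ) (z : Fin (N + 1) → X × Y) : Prop :=
  (∀ k, z k ∈ G) ∧ z 0 = p ∧ z (Fin.last N) = q ∧
    ∀ k : Fin N, (MaxBall c (z k.castSucc) ∩ MaxBall c (z k.succ) ∩ G).Nonempty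

theorem dist_le_dist2 [PseudoMetricSpace X] [PseudoMetricSpace Y] (p q : X × Y) :
    dist p q ≤ dist2 p q := by
  rw [Prod.dist_eq]
  exact max_le (Real.le_sqrt_of_sq_le (le_add_of_nonneg_right (sq_nonneg _)))
    (Real.le_sqrt_of_sq_le (le_add_of_nonneg_left (sq_nonneg _)))

theorem ball2_mem_nhds [PseudoMetricSpace X] [PseudoMetricSpace Y] (p : X × Y) {r : ℝ}
    (hr : 0 < r) : ball2 p r ∈ nhds p := by
  have hcont : Continuous (dist2 p) := by unfold dist2; fun_prop
  refine (isOpen_lt hcont continuous_const).mem_nhds ?_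
  simpa [dist2] using hr

theorem maxBall_mem_nhds [PseudoMetricSpace X] [PseudoMetricSpace Y] {c : X × Y → EReal}
    (hD : IsOpen (Dom c)) {p : X × Y} (hp : p ∈ Dom c) : MaxBall c p ∈ nhds p := by
  obtain ⟨r, hr, hball⟩ := Metric.isOpen_iff.mp hD p hp
  refine Filter.mem_of_superset (ball2_mem_nhds p hr) fun q hq => ⟨r, hr, fun x hx => ?_, hq⟩
  exact hball (Metric.mem_ball'.mpr ((dist_le_dist2 p x).trans_lt hx))

/-- Two points of `G` are linked if their maximal balls meet inside `G`. -/
def BallLinked [PseudoMetricSpace X] [PseudoMetricSpace Y]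
    (c : X × Y → EReal) (G : Set (X × Y)) (p q : X × Y) : Prop :=
  p ∈ G ∧ q ∈ G ∧ (MaxBall c p ∩ MaxBall c q ∩ G).Nonempty

theorem BallLinked.symm [PseudoMetricSpace X] [PseudoMetricSpace Y]
    {c : X × Y → EReal} {G : Set (X × Y)} {p q : X × Y} (h : BallLinked c G p q) :
    BallLinked c G q p :=
  ⟨h.2.1, h.1, Set.inter_comm (MaxBall c p) (MaxBall c q) ▸ h.2.2⟩

theorem IsBallChain.cons [PseudoMetricSpace X] [PseudoMetricSpace Y]
    {c : X × Y → EReal} {G : Set (X × Y)} {p q r : X × Y} {N : ℕ} {z : Fin (N + 1) → X × Y}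
    (hpq : BallLinked c G p q) (hz : IsBallChain c G q r N z) :
    IsBallChain c G p r (N + 1) (Fin.cons p z : Fin (N + 2) → X × Y) := by
  obtain ⟨hG, h0, hlast, hstep⟩ := hz
  refine ⟨Fin.cases hpq.1 hG, rfl, ?_, Fin.cases ?_ fun k => hstep k⟩
  · rw [← Fin.succ_last, Fin.cons_succ, hlast]
  · rw [Fin.cons_succ, Fin.castSucc_zero, Fin.cons_zero, h0]
    exact hpq.2.2

theorem exists_isBallChain_of_reflTransGen [PseudoMetricSpace X] [PseudoMetricSpace Y]
    {c : X × Y → EReal} {G : Set (X × Y)} {p q : X × Y} (hq : q ∈ G)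
    (h : Relation.ReflTransGen (BallLinked c G) p q) :
    ∃ (N : ℕ) (z : Fin (N + 1) → X × Y), IsBallChain c G p q N z := by
  induction h using Relation.ReflTransGen.head_induction_on with
  | refl => exact ⟨0, fun _ => q, fun _ => hq, rfl, rfl, fun k => k.elim0⟩
  | head hlink _ ih =>
    obtain ⟨N, z, hz⟩ := ih
    exact ⟨N + 1, _, hz.cons hlink⟩

/-- in metric spaces with open domain, a nonempty topologically connected
subset of the domain is ball chain connected. -/
theorem ballChainConnected_of_connected [MetricSpace X] [MetricSpace Y]
    (c : X × Y → EReal) (hbot : ∀ p, c p ≠ ⊥) (hD : IsOpen (Dom c))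
    (G : Set (X × Y)) (hne : G.Nonempty) (hGD : G ⊆ Dom c)
    (hconn : IsConnected G) :
    ∀ p ∈ G, ∀ q ∈ G, ∃ (N : ℕ) (z : Fin (N + 1) → X × Y), IsBallChain c G p q N z := by
  intro p hp q hq
  refine exists_isBallChain_of_reflTransGen hq ?_
  refine hconn.isPreconnected.induction₂ (Relation.ReflTransGen (BallLinked c G))
    (fun x hx => ?_) (fun _ _ _ _ _ _ => Relation.ReflTransGen.trans)
    (fun x y _ _ h =>
      have : Std.Symm (BallLinked c G) := ⟨fun _ _ => BallLinked.symm⟩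
      Relation.ReflTransGen.stdSymm.symm x y h) hp hq
  filter_upwards [mem_nhdsWithin_of_mem_nhds (maxBall_mem_nhds hD (hGD hx)),
    self_mem_nhdsWithin] with y hy hyG
  exact .single ⟨hx, hyG, y, ⟨hy, mem_of_mem_nhds (maxBall_mem_nhds hD (hGD hyG))⟩, hyG⟩

end Paper
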